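/- In a two-agent market with two trades, if the best response sequence does not terminate and hence eventually cycles, then every row of the cycle contains a maximal A-string or a maximal R-string of even length. -/

import Mathlib

open Finset

/-- A trading market: a set `I` of agents, a set `Ω` of bilateral trades, each with a
buyer and a distinct seller, integer-valued valuations over bundles of trades, and a
(unique, tie-broken) demanded bundle at every price vector. -/
structure Market (I Ω : Type) [DecidableEq I] where
  buyer : Ω → I
  seller : Ω → I
  buyer_ne_seller : ∀ ω, buyer ω ≠ seller ω
  v : I → Finset Ω → ℤ
  demand : I → (Ω → ℤ) → Finset Ω
  demand_involves : ∀ i p, ∀ ω ∈ demand i p, buyer ω = i ∨ seller ω = i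
  demand_max : ∀ (i : I) (p : Ω → ℤ) (Ψ : Finset Ω),
    (∀ ω ∈ Ψ, buyer ω = i ∨ seller ω = i) →
    v i Ψ - ∑ ω ∈ Ψ, (if buyer ω = i then (1 : ℤ) else if seller ω = i then -1 else 0) * p ω ≤
      v i (demand i p) -
        ∑ ω ∈ demand i p,
          (if buyer ω = i then (1 : ℤ) else if seller ω = i then -1 else 0) * p ω

/-- A state of the market dynamic: the set of unsatisfied agents and the current offers
`offers i ω` of agent `i` for trade `ω`. -/
structure MState (I Ω : Type) where
  unsat : Finset I
  offers : I → Ω → ℤ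

namespace Market

variable {I Ω : Type} [Fintype I] [DecidableEq I] [Fintype Ω] [DecidableEq Ω]

/-- The sign `χ^i_ω`: `1` if `i` buys `ω`, `-1` if `i` sells `ω`, `0` otherwise. -/
def chi (M : Market I Ω) (i : I) (ω : Ω) : ℤ :=
  if M.buyer ω = i then 1 else if M.seller ω = i then -1 else 0

/-- Quasilinear utility of agent `i` for bundle `Ψ` at prices `p`. -/
def utility (M : Market I Ω) (i : I) (Ψ : Finset Ω) (p : Ω → ℤ) : ℤ :=
  M.v i Ψ - ∑ ω ∈ Ψ, M.chi i ω * p ω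

/-- The valuation of the empty bundle is `0`. -/
def Normalized (M : Market I Ω) : Prop := ∀ i : I, M.v i (∅ : Finset Ω) = 0

/-- The prices facing agent `i`: the counterpart's offer `σ^{-i}_ω` for each trade `ω`. -/
def price (M : Market I Ω) (σ : I → Ω → ℤ) (i : I) (ω : Ω) : ℤ :=
  if M.buyer ω = i then σ (M.seller ω) ω else σ (M.buyer ω) ω

/-- The best response (with step size `ε = 1`) of agent `i` given current offers `σ`:
she matches the counterpart's offer on the trades she demands, and moves off by `1`
(in her favourable direction) otherwise.  Offers of other agents are unchanged. -/
def bestResponse (M : Market I Ω) (σ : I → Ω → ℤ) (i : I) : I → Ω → ℤ := fun j ω =>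
  if j = i ∧ (M.buyer ω = i ∨ M.seller ω = i) then
    (if ω ∈ M.demand i (M.price σ i) then M.price σ i ω
     else M.price σ i ω - M.chi i ω)
  else σ j ω

/-- One step of the market dynamic: agent `i` best responds, becomes satisfied, and all
counterparts facing a modified offer become unsatisfied. -/
def mstep (M : Market I Ω) (s : MState I Ω) (i : I) : MState I Ω :=
  { unsat := (s.unsat.erase i) ∪ (Finset.univ.filter fun j =>
      j ≠ i ∧ ∃ ω : Ω,
        ((M.buyer ω = i ∧ M.seller ω = j) ∨ (M.buyer ω = j ∧ M.seller ω = i)) ∧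
        M.bestResponse s.offers i i ω ≠ s.offers i ω),
    offers := M.bestResponse s.offers i }

/-- Running the dynamic along a finite sequence of best-responding agents. -/
def mrun (M : Market I Ω) : MState I Ω → List I → MState I Ω
  | s, [] => s
  | s, i :: L => M.mrun (M.mstep s i) L

/-- A best response sequence of the dynamic is valid if every selected agent is
unsatisfied when selected. -/
def ValidSeq (M : Market I Ω) : MState I Ω → List I → Prop
  | _, [] => True
  | s, i :: L => i ∈ s.unsat ∧ M.ValidSeq (M.mstep s i) L

/-- A (valid) best response sequence after which the market dynamic terminates, i.e.,
all agents are satisfied. -/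
def TerminatingSeq (M : Market I Ω) (s : MState I Ω) (L : List I) : Prop :=
  M.ValidSeq s L ∧ (M.mrun s L).unsat = ∅

/-- Full substitutability of the demand of agent `i` (Hatfield et al.). -/
def FullySubstitutable (M : Market I Ω) (i : I) : Prop :=
  ∀ p p' : Ω → ℤ,
    (((∀ ω, M.seller ω = i → p ω = p' ω) ∧ (∀ ω, M.buyer ω = i → p' ω ≤ p ω)) →
      ((∀ ω ∈ M.demand i p, M.seller ω = i → ω ∈ M.demand i p') ∧
       (∀ ω ∈ M.demand i p', M.buyer ω = i → p ω = p' ω → ω ∈ M.demand i p))) ∧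
    (((∀ ω, M.buyer ω = i → p ω = p' ω) ∧ (∀ ω, M.seller ω = i → p ω ≤ p' ω)) →
      ((∀ ω ∈ M.demand i p, M.buyer ω = i → ω ∈ M.demand i p') ∧
       (∀ ω ∈ M.demand i p', M.seller ω = i → p ω = p' ω → ω ∈ M.demand i p)))

/-- A market with fully substitutable agents. -/
def FSM (M : Market I Ω) : Prop := ∀ i : I, M.FullySubstitutable i

end Market

namespace Market

variable {Ω : Type} [Fintype Ω] [DecidableEq Ω]

/-- The alternating best response dynamic of a two-agent market, starting with agent `a`:
`altRun M s a n` is the state after `n` best responses. -/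
def altRun (M : Market Bool Ω) : MState Bool Ω → Bool → ℕ → MState Bool Ω
  | s, _, 0 => s
  | s, a, n + 1 => M.altRun (M.mstep s a) (!a) n

/-- The alternating best response dynamic terminates (all agents become satisfied). -/
def AltConverges (M : Market Bool Ω) (s : MState Bool Ω) (a : Bool) : Prop :=
  ∃ n : ℕ, (M.altRun s a n).unsat = ∅

end Market

/-- The agent performing the `n`-th best response (0-indexed) of the alternating dynamic
started by agent `a`. -/
def altAgent (a : Bool) (n : ℕ) : Bool := if n % 2 = 0 then a else !a

namespace Market

variable {Ω : Type} [Fintype Ω] [DecidableEq Ω]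

/-- The accept/reject column entries of the alternating best response sequence:
`col M s a n ω = true` means the `n`-th best response accepts (demands) trade `ω`
("A"), and `false` means it rejects it ("R"). -/
def col (M : Market Bool Ω) (s : MState Bool Ω) (a : Bool) (n : ℕ) (ω : Ω) : Bool :=
  decide (ω ∈ M.demand (altAgent a n) (M.price (M.altRun s a n).offers (altAgent a n)))

end Market

/-- A two-valued sequence whose switches always happen at the same phase of the sign `e` makes
the price `p` drift, so a bounded price allows only finitely many switches. -/
theorem exists_forall_eq_succ_of_phase (c : ℕ → Bool) (p e : ℕ → ℤ) (B δ : ℤ) (N : ℕ)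
    (he : ∀ n, e n = 1 ∨ e n = -1) (hes : ∀ n, e (n + 1) = -e n)
    (hp : ∀ n, p (n + 1) = p n - if c n then 0 else e n)
    (hB : ∀ n, |p n| ≤ B) (hδ : δ = 1 ∨ δ = -1)
    (hph : ∀ n, N ≤ n → c n ≠ c (n + 1) → e n = if c n then -δ else δ) :
    ∃ n, N ≤ n ∧ ∀ m, n ≤ m → c m = c (m + 1) := by
  by_contra! hcon
  let F : ℕ → ℤ := fun n =>
    2 * (δ * p n) + (if c n then 1 else 0) + (if c n = false ∧ e n = -δ then 2 else 0)
  have hF : ∀ n, N ≤ n → F (n + 1) ≤ F n ∧ (c n ≠ c (n + 1) → F (n + 1) < F n) := by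
    intro n hn
    have h1 := hph n hn
    have h2 := hp n
    have h3 := hes n
    have h4 := he n
    simp only [F, h2, h3]
    cases hc : c n <;> cases hc' : c (n + 1) <;> rcases hδ with rfl | rfl <;>
      rcases h4 with h4 | h4 <;> simp_all <;> omega
  have hmono : ∀ n, N ≤ n → ∀ k, F (n + k) ≤ F n := by
    intro n hn k
    induction k with
    | zero => simp
    | succ k ih => exact ((hF (n + k) (by omega)).1).trans ih
  have hdec : ∀ k : ℕ, ∃ n, N ≤ n ∧ F n ≤ F N - k := by
    intro k
    induction k with
    | zero => exact ⟨N, le_rfl, by simp⟩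
    | succ k ih =>
      obtain ⟨n, hn, hk⟩ := ih
      obtain ⟨m, hm, hc⟩ := hcon n hn
      have h1 := (hF m (by omega)).2 hc
      have h2 := hmono n hn (m - n)
      rw [Nat.add_sub_cancel' hm] at h2
      exact ⟨m + 1, by omega, by push_cast; omega⟩
  have hlow : ∀ n, -(2 * B) ≤ F n := by
    intro n
    have h1 := abs_le.1 (hB n)
    simp only [F]
    rcases hδ with rfl | rfl <;> split_ifs <;> omega
  obtain ⟨n, -, hn⟩ := hdec (F N + 2 * B + 1).toNat
  have := hlow n
  have := hlow N
  omega

/-- A sequence with arbitrarily late switches, whose price is bounded, has arbitrarily late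
maximal constant strings of even length. -/
theorem exists_even_maximal_string (c : ℕ → Bool) (p e : ℕ → ℤ) (B : ℤ) (N : ℕ)
    (he : ∀ n, e n = 1 ∨ e n = -1) (hes : ∀ n, e (n + 1) = -e n)
    (hp : ∀ n, p (n + 1) = p n - if c n then 0 else e n)
    (hB : ∀ n, |p n| ≤ B) (hsw : ∀ n, ∃ m, n ≤ m ∧ c m ≠ c (m + 1)) :
    ∃ n, N ≤ n ∧ ∃ L : ℕ, 0 < L ∧ Even L ∧ c n ≠ c (n + 1) ∧
      (∀ j, 1 ≤ j → j ≤ L → c (n + j) = c (n + 1)) ∧ c (n + L + 1) ≠ c (n + 1) := by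
  by_contra hcon
  obtain ⟨n₀, hn₀, hc₀⟩ := hsw N
  have hpar : ∀ n k, e (n + k) = if Even k then e n else -e n := by
    intro n k
    induction k with
    | zero => simp
    | succ k ih =>
      rw [← add_assoc, hes, ih]
      by_cases hk : Even k <;> simp [hk, Nat.even_add_one]
  have hgap : ∀ k n, n₀ ≤ n → c n ≠ c (n + 1) → (∀ j, 1 ≤ j → j ≤ k → c (n + j) = c (n + 1)) →
      c (n + k + 1) ≠ c (n + 1) → 0 < k → ¬ Even k := fun k n hn h1 h2 h3 h4 h5 =>
    hcon ⟨n, by omega, k, h4, h5, h1, h2, h3⟩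
  let δ : ℤ := if c n₀ then -e n₀ else e n₀
  have hδ : δ = 1 ∨ δ = -1 := by
    have := he n₀
    simp only [δ]
    split_ifs <;> omega
  have hph : ∀ k, c (n₀ + k) ≠ c (n₀ + k + 1) →
      e (n₀ + k) = if c (n₀ + k) then -δ else δ := by
    intro k
    induction k using Nat.strong_induction_on with
    | _ k ih =>
      intro hk
      rcases Nat.eq_zero_or_pos k with rfl | hpos
      · simp only [δ, add_zero]
        split_ifs <;> simp
      let S := (Finset.range k).filter fun j => c (n₀ + j) ≠ c (n₀ + j + 1)
      have hS : S.Nonempty := ⟨0, by simpa [S] using ⟨hpos, hc₀⟩⟩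
      obtain ⟨hjk, hj⟩ : S.max' hS < k ∧ c (n₀ + S.max' hS) ≠ c (n₀ + S.max' hS + 1) := by
        simpa [S] using S.max'_mem hS
      have hmax : ∀ i, S.max' hS < i → i < k → c (n₀ + i) = c (n₀ + i + 1) := by
        intro i h1 h2
        by_contra h3
        exact absurd (S.le_max' i (by simp [S, h2, h3])) (by omega)
      generalize S.max' hS = j at hjk hj hmax
      obtain ⟨l, rfl⟩ := Nat.exists_eq_add_of_lt hjk
      have hconst : ∀ i, i ≤ l → c (n₀ + j + (i + 1)) = c (n₀ + j + 1) := by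
        intro i
        induction i with
        | zero => simp
        | succ i ihi =>
          intro hi
          rw [← ihi (by omega)]
          simpa only [add_assoc] using (hmax (j + (i + 1)) (by omega) (by omega)).symm
      have hl := hconst l le_rfl
      have hodd := hgap (l + 1) (n₀ + j) (by omega) hj
        (fun i h1 h2 => by
          obtain ⟨i, rfl⟩ := Nat.exists_eq_add_of_le' h1
          exact hconst i (by omega))
        (fun h => hk (by rw [← add_assoc n₀, ← add_assoc n₀, add_assoc (n₀ + j) l 1, hl, h]))
        (by omega)
      have h1 := hpar (n₀ + j) (l + 1)
      rw [if_neg hodd, ih j hjk hj] at h1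
      have h2 : n₀ + (j + l + 1) = n₀ + j + (l + 1) := by omega
      rw [h2, h1, hl]
      cases h3 : c (n₀ + j) <;> cases h4 : c (n₀ + j + 1) <;> simp_all
  obtain ⟨n, -, h⟩ := exists_forall_eq_succ_of_phase c p e B δ n₀ he hes hp hB hδ
    (fun n hn => by
      obtain ⟨k, rfl⟩ := Nat.exists_eq_add_of_le hn
      exact hph k)
  obtain ⟨m, hm, hc⟩ := hsw n
  exact hc (h m hm)

theorem altAgent_not (a : Bool) (n : ℕ) : altAgent (!a) n = altAgent a (n + 1) := by
  unfold altAgent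
  rcases Nat.mod_two_eq_zero_or_one n with h | h <;> cases a <;> simp [h, Nat.add_mod]

theorem altAgent_succ (a : Bool) (n : ℕ) : altAgent a (n + 1) = !altAgent a n := by
  unfold altAgent
  rcases Nat.mod_two_eq_zero_or_one n with h | h <;> cases a <;> simp [h, Nat.add_mod]

namespace Market

section TwoAgents

variable {Ω : Type}

theorem seller_eq_not (M : Market Bool Ω) (ω : Ω) : M.seller ω = !M.buyer ω :=
  Bool.eq_not.2 (M.buyer_ne_seller ω).symm

theorem chi_eq (M : Market Bool Ω) (i : Bool) (ω : Ω) :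
    M.chi i ω = if M.buyer ω = i then 1 else -1 := by
  unfold chi
  rw [M.seller_eq_not]
  cases M.buyer ω <;> cases i <;> simp

theorem chi_not (M : Market Bool Ω) (i : Bool) (ω : Ω) : M.chi (!i) ω = -M.chi i ω := by
  simp only [chi_eq]
  cases M.buyer ω <;> cases i <;> simp

theorem buyer_or_seller (M : Market Bool Ω) (i : Bool) (ω : Ω) :
    M.buyer ω = i ∨ M.seller ω = i := by
  rw [M.seller_eq_not]
  cases M.buyer ω <;> cases i <;> simp

theorem price_eq (M : Market Bool Ω) (σ : Bool → Ω → ℤ) (i : Bool) (ω : Ω) :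
    M.price σ i ω = σ (!i) ω := by
  unfold price
  rw [M.seller_eq_not]
  cases M.buyer ω <;> cases i <;> simp

variable [Fintype Ω] [DecidableEq Ω]

theorem altRun_succ (M : Market Bool Ω) (s : MState Bool Ω) (a : Bool) (n : ℕ) :
    M.altRun s a (n + 1) = M.mstep (M.altRun s a n) (altAgent a n) := by
  induction n generalizing s a with
  | zero => simp [altRun, altAgent]
  | succ n ih => rw [altRun, ih, altAgent_not]; rfl

/-- The price of trade `ω` faced by the agent performing the `n`-th best response. -/
def altPrice (M : Market Bool Ω) (s : MState Bool Ω) (a : Bool) (n : ℕ) (ω : Ω) : ℤ :=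
  M.price (M.altRun s a n).offers (altAgent a n) ω

theorem altPrice_succ (M : Market Bool Ω) (s : MState Bool Ω) (a : Bool) (n : ℕ) (ω : Ω) :
    M.altPrice s a (n + 1) ω =
      M.altPrice s a n ω - if M.col s a n ω then 0 else M.chi (altAgent a n) ω := by
  unfold altPrice
  rw [price_eq, altRun_succ, altAgent_succ, Bool.not_not]
  simp only [mstep, bestResponse, M.buyer_or_seller, col, and_self, if_true, decide_eq_true_eq]
  split_ifs <;> simp

/-- If the dynamic does not terminate, consecutive columns differ in some row. -/
theorem exists_col_ne_col_succ (M : Market Bool Ω) (s : MState Bool Ω) (a : Bool)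
    (hnt : ¬ M.AltConverges s a) (n : ℕ) : ∃ ω, M.col s a n ω ≠ M.col s a (n + 1) ω := by
  have hne : (M.altRun s a (n + 2)).unsat ≠ ∅ := fun h => hnt ⟨n + 2, h⟩
  have hsub : (M.altRun s a (n + 1)).unsat.erase (altAgent a (n + 1)) = ∅ := by
    ext j
    rw [altRun_succ, altAgent_succ]
    cases altAgent a n <;> cases j <;> simp [mstep]
  obtain ⟨j, hj⟩ := Finset.nonempty_iff_ne_empty.2 hne
  rw [altRun_succ M s a (n + 1)] at hj
  simp only [mstep, hsub, Finset.empty_union, Finset.mem_filter] at hj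
  obtain ⟨-, -, ω, -, hω⟩ := hj
  refine ⟨ω, fun hc => hω ?_⟩
  have hnew : M.bestResponse (M.altRun s a (n + 1)).offers (altAgent a (n + 1))
      (altAgent a (n + 1)) ω = M.altPrice s a (n + 2) ω := by
    unfold altPrice
    rw [price_eq, altRun_succ M s a (n + 1), altAgent_succ a (n + 1), Bool.not_not]
    rfl
  have hold : (M.altRun s a (n + 1)).offers (altAgent a (n + 1)) ω = M.altPrice s a n ω := by
    unfold altPrice
    rw [price_eq, altRun_succ, altAgent_succ]
    simp [mstep, bestResponse]
  rw [hnew, hold, altPrice_succ, altPrice_succ, ← hc, altAgent_succ, chi_not]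
  split_ifs <;> ring

/-- Trades are accepted or rejected according to the sign of extreme prices. -/
theorem exists_demand_bound (M : Market Bool Ω) : ∃ K : ℤ, 0 ≤ K ∧ ∀ i p ω,
    (ω ∈ M.demand i p → M.chi i ω * p ω ≤ K) ∧ (ω ∉ M.demand i p → -K ≤ M.chi i ω * p ω) := by
  have hV : ∀ i Ψ, |M.v i Ψ| ≤ ∑ i, ∑ Ψ, |M.v i Ψ| := fun i Ψ =>
    (Finset.single_le_sum (f := fun Ψ => |M.v i Ψ|) (fun _ _ => abs_nonneg _)
      (Finset.mem_univ Ψ)).trans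
    (Finset.single_le_sum (f := fun i => ∑ Ψ, |M.v i Ψ|)
      (fun _ _ => Finset.sum_nonneg fun _ _ => abs_nonneg _) (Finset.mem_univ i))
  generalize (∑ i, ∑ Ψ, |M.v i Ψ|) = V at hV
  have hV0 : 0 ≤ V := (abs_nonneg _).trans (hV true ∅)
  have hmax : ∀ i p Ψ, M.v i Ψ - ∑ ω ∈ Ψ, M.chi i ω * p ω ≤
      M.v i (M.demand i p) - ∑ ω ∈ M.demand i p, M.chi i ω * p ω := fun i p Ψ =>
    M.demand_max i p Ψ fun ω _ => M.buyer_or_seller i ω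
  refine ⟨2 * V, by omega, fun i p ω => ⟨fun h => ?_, fun h => ?_⟩⟩
  · have h1 := hmax i p ((M.demand i p).erase ω)
    have h2 := Finset.add_sum_erase _ (fun ω => M.chi i ω * p ω) h
    have h3 := abs_le.1 (hV i (M.demand i p))
    have h4 := abs_le.1 (hV i ((M.demand i p).erase ω))
    linarith
  · have h1 := hmax i p (insert ω (M.demand i p))
    rw [Finset.sum_insert h] at h1
    have h3 := abs_le.1 (hV i (M.demand i p))
    have h4 := abs_le.1 (hV i (insert ω (M.demand i p)))
    linarith

theorem exists_abs_altPrice_le (M : Market Bool Ω) (s : MState Bool Ω) (a : Bool) (ω : Ω) :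
    ∃ B : ℤ, ∀ n, |M.altPrice s a n ω| ≤ B := by
  obtain ⟨K, hK, hd⟩ := M.exists_demand_bound
  refine ⟨|M.altPrice s a 0 ω| + K + 1, fun n => ?_⟩
  have h0 := abs_nonneg (M.altPrice s a 0 ω)
  induction n with
  | zero => omega
  | succ n ih =>
    have h := hd (altAgent a n) (M.price (M.altRun s a n).offers (altAgent a n)) ω
    change (_ → _ * M.altPrice s a n ω ≤ K) ∧ (_ → -K ≤ _ * M.altPrice s a n ω) at h
    rw [altPrice_succ]
    rw [abs_le] at ih ⊢
    simp only [col, decide_eq_true_eq, chi_eq] at h ⊢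
    split_ifs at h ⊢ with h1 h2 h2
    · omega
    · omega
    · have := h.2 h1
      omega
    · have := h.2 h1
      omega

end TwoAgents

end Market

/-- In a two-agent market with two trades whose alternating best response
sequence does not terminate (and hence eventually cycles), every row of the cycle
contains a maximal A-string or a maximal R-string of even length: arbitrarily late in
the sequence there is a maximal run of equal entries of even length. -/
theorem cycle_row_has_even_maximal_string
    (M : Market Bool (Fin 2)) (hN : M.Normalized)
    (s : MState Bool (Fin 2)) (a : Bool)
    (hnt : ¬ M.AltConverges s a) :
    ∀ (ω : Fin 2) (N : ℕ), ∃ n, N ≤ n ∧ ∃ L : ℕ, 0 < L ∧ Even L ∧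
      M.col s a n ω ≠ M.col s a (n + 1) ω ∧
      (∀ j, 1 ≤ j → j ≤ L → M.col s a (n + j) ω = M.col s a (n + 1) ω) ∧
      M.col s a (n + L + 1) ω ≠ M.col s a (n + 1) ω := by
  intro ω N
  have he : ∀ ω n, M.chi (altAgent a n) ω = 1 ∨ M.chi (altAgent a n) ω = -1 := by
    intro ω n
    rw [M.chi_eq]
    split_ifs <;> simp
  have hes : ∀ ω n, M.chi (altAgent a (n + 1)) ω = -M.chi (altAgent a n) ω := by
    intro ω n
    rw [altAgent_succ, M.chi_not]
  obtain ⟨B, hB⟩ := M.exists_abs_altPrice_le s a ω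
  refine exists_even_maximal_string (fun n => M.col s a n ω) (fun n => M.altPrice s a n ω)
    (fun n => M.chi (altAgent a n) ω) B N (he ω) (hes ω)
    (fun n => M.altPrice_succ s a n ω) hB ?_
  by_contra! hconst
  obtain ⟨n₀, hn₀⟩ := hconst
  obtain ⟨ω', hω'⟩ : ∃ ω' : Fin 2, ∀ x, x = ω ∨ x = ω' := by
    refine ⟨1 - ω, fun x => ?_⟩
    fin_cases ω <;> fin_cases x <;> simp
  have halt : ∀ n, n₀ ≤ n → M.col s a n ω' ≠ M.col s a (n + 1) ω' := by
    intro n hn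
    obtain ⟨x, hx⟩ := M.exists_col_ne_col_succ s a hnt n
    rcases hω' x with rfl | rfl
    · exact absurd (hn₀ n hn) hx
    · exact hx
  obtain ⟨B', hB'⟩ := M.exists_abs_altPrice_le s a ω'
  obtain ⟨n, h1, L, hL0, hL, -, hrun, -⟩ := exists_even_maximal_string
    (fun n => M.col s a n ω') (fun n => M.altPrice s a n ω')
    (fun n => M.chi (altAgent a n) ω') B' n₀ (he ω') (hes ω')
    (fun n => M.altPrice_succ s a n ω') hB'
    (fun n => ⟨max n n₀, le_max_left _ _, halt _ (le_max_right _ _)⟩)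
  have hL2 : 2 ≤ L := by
    obtain ⟨k, rfl⟩ := hL
    omega
  exact halt (n + 1) (by omega) (hrun 2 (by norm_num) hL2).symm
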